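/- Let Q be symmetric positive semidefinite, R symmetric positive definite, p₁ ∈ [0,1], and Σ₀ symmetric positive semidefinite. For λ ∈ [0,1] define the iterates V(λ, 0) = Σ₀ and V(λ, k+1) = g_{λ·p₁}(V(λ, k)). If 0 ≤ λ₂ ≤ λ₁ ≤ 1, then V(λ₁, k) ⪯ V(λ₂, k) for every k ≥ 0; in particular Tr(V(λ₁, k)) ≤ Tr(V(λ₂, k)) for all k. (Lemma 2, second part: the user's upper-bound iterates, and hence their limit Tr V(p), are non-increasing in the transmission probability.) -/

import Mathlib

open Matrix Filter

noncomputable def gOp {n m : ℕ} (A : Matrix (Fin n) (Fin n) ℝ) (C : Matrix (Fin m) (Fin n) ℝ)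
    (Q : Matrix (Fin n) (Fin n) ℝ) (R : Matrix (Fin m) (Fin m) ℝ)
    (lam : ℝ) (X : Matrix (Fin n) (Fin n) ℝ) : Matrix (Fin n) (Fin n) ℝ :=
  A * X * Aᵀ + Q - lam • (A * X * Cᵀ * (C * X * Cᵀ + R)⁻¹ * C * X * Aᵀ)

section Helpers

variable {n m : ℕ}

noncomputable def gainMat (C : Matrix (Fin m) (Fin n) ℝ) (R : Matrix (Fin m) (Fin m) ℝ)
    (X : Matrix (Fin n) (Fin n) ℝ) : Matrix (Fin n) (Fin m) ℝ :=
  X * Cᵀ * (C * X * Cᵀ + R)⁻¹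

noncomputable def hOp (C : Matrix (Fin m) (Fin n) ℝ) (R : Matrix (Fin m) (Fin m) ℝ)
    (X : Matrix (Fin n) (Fin n) ℝ) : Matrix (Fin n) (Fin n) ℝ :=
  X - X * Cᵀ * (C * X * Cᵀ + R)⁻¹ * C * X

def fOp (C : Matrix (Fin m) (Fin n) ℝ) (R : Matrix (Fin m) (Fin m) ℝ)
    (K : Matrix (Fin n) (Fin m) ℝ)
    (X : Matrix (Fin n) (Fin n) ℝ) : Matrix (Fin n) (Fin n) ℝ :=
  (1 - K * C) * X * (1 - K * C)ᵀ + K * R * Kᵀ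

lemma psd_conj {a b : ℕ} {X : Matrix (Fin a) (Fin a) ℝ} (hX : X.PosSemidef)
    (B : Matrix (Fin b) (Fin a) ℝ) : (B * X * Bᵀ).PosSemidef := by
  have := hX.mul_mul_conjTranspose_same B
  rwa [conjTranspose_eq_transpose_of_trivial] at this

lemma innov_posDef (C : Matrix (Fin m) (Fin n) ℝ) {R : Matrix (Fin m) (Fin m) ℝ}
    (hR : R.PosDef) {X : Matrix (Fin n) (Fin n) ℝ} (hX : X.PosSemidef) :
    (C * X * Cᵀ + R).PosDef := Matrix.PosDef.posSemidef_add (psd_conj hX C) hR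

lemma psd_symm {a : ℕ} {X : Matrix (Fin a) (Fin a) ℝ} (hX : X.PosSemidef) : Xᵀ = X := by
  have := hX.isHermitian.eq
  rwa [conjTranspose_eq_transpose_of_trivial] at this

lemma fOp_eq (C : Matrix (Fin m) (Fin n) ℝ) {R : Matrix (Fin m) (Fin m) ℝ}
    (hR : R.PosDef) {X : Matrix (Fin n) (Fin n) ℝ} (hX : X.PosSemidef)
    (K : Matrix (Fin n) (Fin m) ℝ) :
    fOp C R K X = hOp C R X +
      (K - gainMat C R X) * (C * X * Cᵀ + R) * (K - gainMat C R X)ᵀ := by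
  have hS := innov_posDef C hR hX
  have hSt : (C * X * Cᵀ + R)ᵀ = C * X * Cᵀ + R := psd_symm hS.posSemidef
  have hXt := psd_symm hX
  have hdet : IsUnit (C * X * Cᵀ + R).det := (Matrix.isUnit_iff_isUnit_det _).1 hS.isUnit
  have h1 : gainMat C R X * (C * X * Cᵀ + R) = X * Cᵀ := by
    unfold gainMat
    rw [Matrix.mul_assoc, Matrix.nonsing_inv_mul _ hdet, Matrix.mul_one]
  have h2 : (gainMat C R X)ᵀ = (C * X * Cᵀ + R)⁻¹ * C * X := by
    unfold gainMat
    rw [transpose_mul, transpose_nonsing_inv, hSt, transpose_mul, transpose_transpose, hXt,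
      ← Matrix.mul_assoc]
  have h3 : (C * X * Cᵀ + R) * (gainMat C R X)ᵀ = C * X := by
    rw [h2, Matrix.mul_assoc _ C X, Matrix.mul_nonsing_inv_cancel_left _ _ hdet]
  have h4 : hOp C R X = X - X * Cᵀ * (gainMat C R X)ᵀ := by
    rw [h2]; unfold hOp; simp only [Matrix.mul_assoc]
  have h5 : (K - gainMat C R X) * (C * X * Cᵀ + R) * (K - gainMat C R X)ᵀ
      = K * (C * X * Cᵀ + R) * Kᵀ - K * (C * X) - X * Cᵀ * Kᵀ
        + X * Cᵀ * (gainMat C R X)ᵀ := by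
    rw [Matrix.sub_mul, h1, transpose_sub, Matrix.mul_sub, Matrix.sub_mul, Matrix.sub_mul,
      Matrix.mul_assoc K _ (gainMat C R X)ᵀ, h3]
    abel
  rw [h5, h4]
  unfold fOp
  simp only [Matrix.sub_mul, Matrix.mul_sub, Matrix.add_mul, Matrix.mul_add, transpose_sub,
    transpose_mul, transpose_one, Matrix.one_mul, Matrix.mul_one, Matrix.mul_assoc]
  abel

lemma hOp_eq_fOp (C : Matrix (Fin m) (Fin n) ℝ) {R : Matrix (Fin m) (Fin m) ℝ}
    (hR : R.PosDef) {X : Matrix (Fin n) (Fin n) ℝ} (hX : X.PosSemidef) :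
    hOp C R X = fOp C R (gainMat C R X) X := by
  rw [fOp_eq C hR hX]; simp

lemma hOp_psd (C : Matrix (Fin m) (Fin n) ℝ) {R : Matrix (Fin m) (Fin m) ℝ}
    (hR : R.PosDef) {X : Matrix (Fin n) (Fin n) ℝ} (hX : X.PosSemidef) :
    (hOp C R X).PosSemidef := by
  rw [hOp_eq_fOp C hR hX]
  exact (psd_conj hX _).add (psd_conj hR.posSemidef _)

lemma hOp_mono (C : Matrix (Fin m) (Fin n) ℝ) {R : Matrix (Fin m) (Fin m) ℝ}
    (hR : R.PosDef) {X Y : Matrix (Fin n) (Fin n) ℝ} (hX : X.PosSemidef) (hY : Y.PosSemidef)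
    (hXY : (Y - X).PosSemidef) : (hOp C R Y - hOp C R X).PosSemidef := by
  have e := fOp_eq C hR hX (gainMat C R Y)
  have : hOp C R Y - hOp C R X =
      (1 - gainMat C R Y * C) * (Y - X) * (1 - gainMat C R Y * C)ᵀ +
      (gainMat C R Y - gainMat C R X) * (C * X * Cᵀ + R) *
        (gainMat C R Y - gainMat C R X)ᵀ := by
    rw [hOp_eq_fOp C hR hY, eq_sub_of_add_eq e.symm,
      Matrix.mul_sub _ Y X, Matrix.sub_mul (_ * Y) (_ * X)]
    unfold fOp
    abel
  rw [this]
  exact (psd_conj hXY _).add (psd_conj (innov_posDef C hR hX).posSemidef _)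

lemma gOp_eq (A : Matrix (Fin n) (Fin n) ℝ) (C : Matrix (Fin m) (Fin n) ℝ)
    (Q : Matrix (Fin n) (Fin n) ℝ) (R : Matrix (Fin m) (Fin m) ℝ)
    (l : ℝ) (X : Matrix (Fin n) (Fin n) ℝ) :
    gOp A C Q R l X = (1 - l) • (A * X * Aᵀ) + l • (A * hOp C R X * Aᵀ) + Q := by
  unfold gOp hOp
  simp only [Matrix.sub_mul, Matrix.mul_sub, Matrix.mul_assoc, sub_smul, smul_sub, one_smul]
  abel

lemma gOp_psd (A : Matrix (Fin n) (Fin n) ℝ) (C : Matrix (Fin m) (Fin n) ℝ)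
    {Q : Matrix (Fin n) (Fin n) ℝ} {R : Matrix (Fin m) (Fin m) ℝ}
    (hQ : Q.PosSemidef) (hR : R.PosDef) {l : ℝ} (h0 : 0 ≤ l) (h1 : l ≤ 1)
    {X : Matrix (Fin n) (Fin n) ℝ} (hX : X.PosSemidef) : (gOp A C Q R l X).PosSemidef := by
  rw [gOp_eq]
  exact (((psd_conj hX A).smul (sub_nonneg.2 h1)).add
    ((psd_conj (hOp_psd C hR hX) A).smul h0)).add hQ

lemma gOp_mono (A : Matrix (Fin n) (Fin n) ℝ) (C : Matrix (Fin m) (Fin n) ℝ)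
    (Q : Matrix (Fin n) (Fin n) ℝ) {R : Matrix (Fin m) (Fin m) ℝ}
    (hR : R.PosDef) {l : ℝ} (h0 : 0 ≤ l) (h1 : l ≤ 1)
    {X Y : Matrix (Fin n) (Fin n) ℝ} (hX : X.PosSemidef) (hY : Y.PosSemidef)
    (hXY : (Y - X).PosSemidef) : (gOp A C Q R l Y - gOp A C Q R l X).PosSemidef := by
  have : gOp A C Q R l Y - gOp A C Q R l X =
      (1 - l) • (A * (Y - X) * Aᵀ) + l • (A * (hOp C R Y - hOp C R X) * Aᵀ) := by
    rw [gOp_eq, gOp_eq]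
    simp only [Matrix.sub_mul, Matrix.mul_sub, smul_sub]
    abel
  rw [this]
  exact ((psd_conj hXY A).smul (sub_nonneg.2 h1)).add
    ((psd_conj (hOp_mono C hR hX hY hXY) A).smul h0)

lemma gOp_anti (A : Matrix (Fin n) (Fin n) ℝ) (C : Matrix (Fin m) (Fin n) ℝ)
    (Q : Matrix (Fin n) (Fin n) ℝ) {R : Matrix (Fin m) (Fin m) ℝ}
    (hR : R.PosDef) {l₁ l₂ : ℝ} (h : l₂ ≤ l₁)
    {X : Matrix (Fin n) (Fin n) ℝ} (hX : X.PosSemidef) :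
    (gOp A C Q R l₂ X - gOp A C Q R l₁ X).PosSemidef := by
  have : gOp A C Q R l₂ X - gOp A C Q R l₁ X =
      (l₁ - l₂) • ((A * X * Cᵀ) * (C * X * Cᵀ + R)⁻¹ * (A * X * Cᵀ)ᵀ) := by
    unfold gOp
    simp only [transpose_mul, transpose_transpose, psd_symm hX, sub_smul, Matrix.mul_assoc]
    abel
  rw [this]
  exact (psd_conj (innov_posDef C hR hX).inv.posSemidef _).smul (sub_nonneg.2 h)

end Helpers

/-- The user's upper-bound iterates `V(λ, k)` of the modified Riccati operator are
non-increasing in the transmission probability λ. -/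
theorem upper_bound_iterates_antitone {n m : ℕ} (hn : 1 ≤ n)
    (A : Matrix (Fin n) (Fin n) ℝ) (C : Matrix (Fin m) (Fin n) ℝ)
    (Q : Matrix (Fin n) (Fin n) ℝ) (R : Matrix (Fin m) (Fin m) ℝ)
    (hQ : Q.PosSemidef) (hR : R.PosDef)
    (p₁ : ℝ) (hp₁ : p₁ ∈ Set.Icc (0 : ℝ) 1)
    (Sig0 : Matrix (Fin n) (Fin n) ℝ) (hSig0 : Sig0.PosSemidef)
    (V : ℝ → ℕ → Matrix (Fin n) (Fin n) ℝ)
    (hV0 : ∀ lam, V lam 0 = Sig0)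
    (hVrec : ∀ lam k, V lam (k + 1) = gOp A C Q R (lam * p₁) (V lam k))
    (lam₁ lam₂ : ℝ) (h0 : 0 ≤ lam₂) (h21 : lam₂ ≤ lam₁) (h1 : lam₁ ≤ 1) :
    ∀ k, (V lam₂ k - V lam₁ k).PosSemidef ∧ (V lam₁ k).trace ≤ (V lam₂ k).trace := by
  have hp0 := hp₁.1
  have hp1 := hp₁.2
  have psd : ∀ l : ℝ, 0 ≤ l → l ≤ 1 → ∀ k, (V l k).PosSemidef := by
    intro l hl0 hl1 k
    induction k with
    | zero => rw [hV0]; exact hSig0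
    | succ k ih =>
      rw [hVrec]
      exact gOp_psd A C hQ hR (mul_nonneg hl0 hp0) (mul_le_one₀ hl1 hp0 hp1) ih
  have main : ∀ k, (V lam₂ k - V lam₁ k).PosSemidef := by
    intro k
    induction k with
    | zero => rw [hV0, hV0, sub_self]; exact Matrix.PosSemidef.zero
    | succ k ih =>
      have hX := psd lam₁ (h0.trans h21) h1 k
      have hY := psd lam₂ h0 (h21.trans h1) k
      rw [hVrec, hVrec, ← sub_add_sub_cancel _ (gOp A C Q R (lam₂ * p₁) (V lam₁ k)) _]
      exact (gOp_mono A C Q hR (mul_nonneg h0 hp0) (mul_le_one₀ (h21.trans h1) hp0 hp1)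
        hX hY ih).add (gOp_anti A C Q hR (mul_le_mul_of_nonneg_right h21 hp0) hX)
  intro k
  refine ⟨main k, ?_⟩
  have := (main k).trace_nonneg
  rw [trace_sub] at this
  linarith
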